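/- arXiv:2401.10474 — 7 statements merged into one kernel-verified Lean document; each statement's English description precedes it below -/
import Mathlib

section
/- Let F : ℝ → ℝ and let r ≠ 0 be a real number such that F is nonzero and continuously differentiable on an open interval containing r. Then the limit as ε → 0 through nonzero values of ln(F((1+ε)·r)/F(r)) / ln((1+ε)·r / r) exists and equals r·F'(r)/F(r). -/
open Filter Real

/-- If `f` and `g` vanish at `a` and are differentiable there with `g' ≠ 0`, then the quotient `f / g`
tends to `f' / g'` at `a`. -/
theorem HasDerivAt.tendsto_div_of_eq_zero {f g : ℝ → ℝ} {f' g' a : ℝ}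
    (hf : HasDerivAt f f' a) (hg : HasDerivAt g g' a)
    (hfa : f a = 0) (hga : g a = 0) (hg' : g' ≠ 0) :
    Tendsto (fun x => f x / g x) (nhdsWithin a {a}ᶜ) (nhds (f' / g')) := by
  refine (hf.tendsto_slope.div hg.tendsto_slope hg').congr' ?_
  filter_upwards [self_mem_nhdsWithin] with x hx
  have hxa : x - a ≠ 0 := sub_ne_zero.mpr hx
  simp only [Pi.div_apply, slope_def_field, hfa, hga, sub_zero]
  exact div_div_div_cancel_right₀ hxa _ _

/-- Intrinsic dimensionality limit theorem: if `F` is nonzero and continuously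
differentiable on an open interval containing `r ≠ 0`, then
`ln(F((1+ε)r)/F(r)) / ln((1+ε)r/r)` tends to `r * F'(r) / F(r)` as `ε → 0`
through nonzero values. -/
theorem stmt_0
    (F : ℝ → ℝ) (r : ℝ) (hr : r ≠ 0)
    (s : Set ℝ) (hs : IsOpen s) (hrs : r ∈ s)
    (hF : ContDiffOn ℝ 1 F s)
    (hF0 : ∀ x ∈ s, F x ≠ 0) :
    Tendsto
      (fun ε : ℝ =>
        Real.log (F ((1 + ε) * r) / F r) / Real.log ((1 + ε) * r / r))
      (nhdsWithin 0 {0}ᶜ)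
      (nhds (r * deriv F r / F r)) := by
  have hFr : F r ≠ 0 := hF0 r hrs
  have hdF : HasDerivAt F (deriv F r) r :=
    ((hF.contDiffAt (hs.mem_nhds hrs)).differentiableAt one_ne_zero).hasDerivAt
  have hlin : HasDerivAt (fun ε : ℝ => (1 + ε) * r) r 0 := by
    simpa using ((hasDerivAt_id (0 : ℝ)).const_add 1).mul_const r
  have hzero : (1 + (0 : ℝ)) * r = r := by ring
  have hnum : HasDerivAt (fun ε : ℝ => Real.log (F ((1 + ε) * r) / F r))
      (r * deriv F r / F r) 0 := by
    have hcomp : HasDerivAt (fun ε : ℝ => F ((1 + ε) * r)) (deriv F r * r) 0 :=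
      HasDerivAt.comp (h₂ := F) 0 (by rwa [hzero]) hlin
    convert (hcomp.div_const (F r)).log (by simpa using hFr) using 1
    simp [hFr, mul_comm]
  have hden : HasDerivAt (fun ε : ℝ => Real.log ((1 + ε) * r / r)) 1 0 := by
    convert (hlin.div_const r).log (by simpa using hr) using 1
    simp [hr]
  simpa using hnum.tendsto_div_of_eq_zero hden (by simp [hFr]) (by simp [hr]) one_ne_zero
end

section
/- For every w > 0 and all θ₁ > 0, θ₂ > 0, the Fisher–Rao distance between H_{w|θ₁} and H_{w|θ₂} equals |ln(θ₂/θ₁)|; explicitly, | ∫_{θ₁}^{θ₂} ( ∫₀^w (1/θ + ln(r/w))² · (θ/w)·(r/w)^{θ−1} dr )^{1/2} dθ | = |ln(θ₂/θ₁)|. -/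
open Real

/-- The antiderivative of the score-squared integrand is continuous up to the endpoint `0`. -/
lemma continuousOn_rpow_mul_add_log_sq {θ : ℝ} (hθ : 0 < θ) (c : ℝ) :
    ContinuousOn (fun x : ℝ => x ^ θ * (c + Real.log x ^ 2)) (Set.Icc 0 1) := by
  intro x hx
  rcases hx.1.eq_or_lt with rfl | hpos
  · have hlog : Filter.Tendsto (fun x : ℝ => (Real.log x * x ^ (θ / 2)) ^ 2)
        (nhdsWithin 0 (Set.Ioi 0)) (nhds 0) := by
      simpa using (tendsto_log_mul_rpow_nhdsGT_zero (half_pos hθ)).pow 2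
    have hpow : Filter.Tendsto (fun x : ℝ => x ^ θ * c)
        (nhdsWithin 0 (Set.Ioi 0)) (nhds 0) := by
      have h := ((Real.continuousAt_rpow_const 0 θ (Or.inr hθ.le)).mul_const c).tendsto
      simp only [Real.zero_rpow hθ.ne', zero_mul] at h
      exact h.mono_left nhdsWithin_le_nhds
    have hsum := hpow.add hlog
    have hcont : ContinuousWithinAt (fun x : ℝ => x ^ θ * (c + Real.log x ^ 2))
        (Set.Ioi 0) 0 := by
      unfold ContinuousWithinAt
      simp only [Real.zero_rpow hθ.ne', zero_mul]
      rw [add_zero] at hsum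
      refine hsum.congr' ?_
      filter_upwards [self_mem_nhdsWithin] with x hx
      have hsplit : x ^ θ = x ^ (θ / 2) * x ^ (θ / 2) := by
        rw [← Real.rpow_add hx, add_halves]
      rw [hsplit]
      ring
    exact (continuousWithinAt_Ioi_iff_Ici.mp hcont).mono Set.Icc_subset_Ici_self
  · exact ((Real.continuousAt_rpow_const x θ (Or.inl hpos.ne')).mul
      (continuousAt_const.add
        ((Real.continuousAt_log hpos.ne').pow 2))).continuousWithinAt

lemma hasDerivAt_rpow_mul_add_log_sq {θ x : ℝ} (hθ : 0 < θ) (hx : 0 < x) :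
    HasDerivAt (fun x : ℝ => x ^ θ * (1 / θ ^ 2 + Real.log x ^ 2))
      ((1 / θ + Real.log x) ^ 2 * (θ * x ^ (θ - 1))) x := by
  have h := (Real.hasDerivAt_rpow_const (p := θ) (Or.inl hx.ne')).mul
    (((Real.hasDerivAt_log hx.ne').pow 2).const_add (1 / θ ^ 2))
  refine h.congr_deriv ?_
  have hsplit : x ^ θ = x ^ (θ - 1) * x := by
    rw [← Real.rpow_add_one hx.ne', sub_add_cancel]
  simp only [hsplit, Pi.pow_apply]
  field_simp
  ring

lemma integral_score_sq_unit {θ : ℝ} (hθ : 0 < θ) :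
    ∫ x in (0:ℝ)..1, (1 / θ + Real.log x) ^ 2 * (θ * x ^ (θ - 1)) = 1 / θ ^ 2 := by
  have hcont := continuousOn_rpow_mul_add_log_sq hθ (1 / θ ^ 2)
  have hderiv : ∀ x ∈ Set.Ioo (0:ℝ) 1, HasDerivAt
      (fun x : ℝ => x ^ θ * (1 / θ ^ 2 + Real.log x ^ 2))
      ((1 / θ + Real.log x) ^ 2 * (θ * x ^ (θ - 1))) x :=
    fun x hx => hasDerivAt_rpow_mul_add_log_sq hθ hx.1
  have hint : IntervalIntegrable
      (fun x : ℝ => (1 / θ + Real.log x) ^ 2 * (θ * x ^ (θ - 1)))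
      MeasureTheory.volume 0 1 := by
    rw [intervalIntegrable_iff_integrableOn_Ioc_of_le zero_le_one]
    refine intervalIntegral.integrableOn_deriv_of_nonneg hcont hderiv fun x hx => ?_
    have := Real.rpow_nonneg hx.1.le (θ - 1)
    positivity
  rw [intervalIntegral.integral_eq_sub_of_hasDerivAt_of_le zero_le_one hcont hderiv hint]
  simp [Real.zero_rpow hθ.ne']

/-- The Fisher information of the smooth growth distribution is `1 / θ ^ 2`. -/
lemma integral_score_sq {w θ : ℝ} (hw : 0 < w) (hθ : 0 < θ) :
    ∫ r in (0:ℝ)..w, (1 / θ + Real.log (r / w)) ^ 2 * ((θ / w) * (r / w) ^ (θ - 1))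
      = 1 / θ ^ 2 := by
  have h := intervalIntegral.inv_mul_integral_comp_div (a := 0) (b := w) (c := w)
    (f := fun x : ℝ => (1 / θ + Real.log x) ^ 2 * (θ * x ^ (θ - 1)))
  rw [zero_div, div_self hw.ne', integral_score_sq_unit hθ,
    ← intervalIntegral.integral_const_mul] at h
  rw [← h]
  congr 1
  funext r
  ring

/-- The Fisher–Rao distance between the smooth growth distributions
`H_{w|θ₁}` and `H_{w|θ₂}` equals `|ln(θ₂/θ₁)|`. -/
theorem stmt_3 (w θ₁ θ₂ : ℝ) (hw : 0 < w) (hθ₁ : 0 < θ₁) (hθ₂ : 0 < θ₂) :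
    |∫ θ in θ₁..θ₂,
        Real.sqrt (∫ r in (0:ℝ)..w,
          (1 / θ + Real.log (r / w)) ^ 2 * ((θ / w) * (r / w) ^ (θ - 1)))|
      = |Real.log (θ₂ / θ₁)| := by
  rw [← integral_one_div_of_pos hθ₁ hθ₂]
  congr 1
  refine intervalIntegral.integral_congr fun θ hθ => ?_
  have hpos : 0 < θ := (lt_min hθ₁ hθ₂).trans_le hθ.1
  simp only [integral_score_sq hw hpos]
  rw [← one_div_pow, Real.sqrt_sq (by positivity)]
end

section
/- Let 0 < r and 0 < w be real numbers and let F : ℝ → ℝ be nonzero and continuously differentiable everywhere on the closed interval [min(r,w), max(r,w)], with F(r)/F(w) > 0. Then for every real constant L (in the paper, L = ID*_F, the local intrinsic dimensionality of F, assumed to exist), the following identity holds: F(r)/F(w) = (r/w)^L · exp( ∫_r^w (L − t·F'(t)/F(t)) / t dt ). -/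
open Real

/-- LID Representation Theorem: if `F` is nonzero and continuously differentiable on
`[min r w, max r w]` with `F r / F w > 0`, then for every real `L`,
`F r / F w = (r/w)^L * exp (∫_r^w (L - t F'(t)/F(t))/t dt)`. -/
theorem stmt_4
    (F : ℝ → ℝ) (r w : ℝ) (hr : 0 < r) (hw : 0 < w)
    (hF : ContDiffOn ℝ 1 F (Set.Icc (min r w) (max r w)))
    (hF0 : ∀ t ∈ Set.Icc (min r w) (max r w), F t ≠ 0)
    (hpos : 0 < F r / F w)
    (L : ℝ) :
    F r / F w
      = (r / w) ^ L *
        Real.exp (∫ t in r..w, (L - t * deriv F t / F t) / t) := by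
  have hFr : F r ≠ 0 := hF0 r ⟨min_le_left _ _, le_max_left _ _⟩
  have hFw : F w ≠ 0 := hF0 w ⟨min_le_right _ _, le_max_right _ _⟩
  rcases eq_or_ne r w with rfl | hne
  · simp [hFr, hr.ne']
  have hlt : min r w < max r w := min_lt_max.mpr hne
  have hpos_Icc : ∀ t ∈ Set.Icc (min r w) (max r w), t ≠ 0 := fun t ht =>
    ((lt_min hr hw).trans_le ht.1).ne'
  have hcont : ContinuousOn
      (fun t => (L - t * derivWithin F (Set.Icc (min r w) (max r w)) t / F t) / t)
      (Set.uIcc r w) :=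
    (continuousOn_const.sub ((continuousOn_id.mul
      (hF.continuousOn_derivWithin (uniqueDiffOn_Icc hlt) le_rfl)).div hF.continuousOn hF0)).div
      continuousOn_id hpos_Icc
  have hint : IntervalIntegrable (fun t => (L - t * deriv F t / F t) / t)
      MeasureTheory.volume r w := by
    refine hcont.intervalIntegrable.congr_uIoo fun t ht => ?_
    simp only [derivWithin_of_mem_nhds (Icc_mem_nhds ht.1 ht.2)]
  have hftc : ∫ t in r..w, (L - t * deriv F t / F t) / t
      = (L * log w - log (F w)) - (L * log r - log (F r)) := by
    refine intervalIntegral.integral_eq_sub_of_hasDeriv_right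
      (f := fun t => L * log t - log (F t)) ?_ (fun t ht => ?_) hint
    · exact (continuousOn_const.mul (continuousOn_id.log hpos_Icc)).sub
        (hF.continuousOn.log hF0)
    · have hmem := Set.Ioo_subset_Icc_self ht
      have ht0 := hpos_Icc t hmem
      have hFt := hF0 t hmem
      have hd : HasDerivAt F (deriv F t) t :=
        ((hF.differentiableOn one_ne_zero).differentiableAt
          (Icc_mem_nhds ht.1 ht.2)).hasDerivAt
      refine ((((hasDerivAt_log ht0).const_mul L).sub (hd.log hFt)).congr_deriv ?_).hasDerivWithinAt
      field_simp
  rw [hftc, rpow_def_of_pos (div_pos hr hw), ← exp_add, log_div hr.ne' hw.ne']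
  calc F r / F w = exp (log (F r / F w)) := (exp_log hpos).symm
    _ = _ := by
      rw [log_div hFr hFw]
      ring_nf
end

section
/- Let c ≥ 1 and b > 0 be real constants, let F : ℝ → ℝ be nonzero and continuously differentiable on (0, b], define ID_F(t) = t·F'(t)/F(t), and suppose ID_F(t) tends to a real limit L as t → 0⁺. Then for every ε > 0 there exists δ > 0 with δ ≤ b such that for all real w and r with 0 < w ≤ δ and w/c ≤ r ≤ c·w (so in particular r ≤ c·δ ≤ b after shrinking δ), one has | exp( ∫_r^w (L − ID_F(t))/t dt ) − 1 | < ε. In other words, the auxiliary factor G_F(r,w) = exp( ∫_r^w (L − ID_F(t))/t dt ) tends to 1 as w → 0⁺ with r constrained to w/c ≤ r ≤ c·w. -/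
open Real Filter

/-- If `g → 0` at `0⁺`, the integral of `g t / t` between `r` and `w` is small for small `w > 0`,
uniformly in `r ∈ [w / c, c * w]`. -/
theorem exists_abs_integral_div_lt {c : ℝ} (hc : 1 ≤ c) {g : ℝ → ℝ}
    (hg : Tendsto g (nhdsWithin 0 (Set.Ioi 0)) (nhds 0)) {κ : ℝ} (hκ : 0 < κ) :
    ∃ δ > (0:ℝ), ∀ w r : ℝ, 0 < w → w ≤ δ → w / c ≤ r → r ≤ c * w →
      |∫ t in r..w, g t / t| < κ := by
  have hc0 : 0 < c := by linarith
  obtain ⟨δ, hδ, hbound⟩ := Metric.tendsto_nhdsWithin_nhds.1 hg (κ / (2 * c ^ 2)) (by positivity)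
  refine ⟨δ / (2 * c), by positivity, fun w r hw hwδ hr₁ hr₂ => ?_⟩
  have hcw : c * w < δ := by
    rw [le_div_iff₀ (by positivity)] at hwδ
    nlinarith
  have hwc : 0 < w / c := by positivity
  have hw_le : w ≤ c * w := le_mul_of_one_le_left hw.le hc
  have hle_w : w / c ≤ w := div_le_self hw.le hc
  have hint : ∀ t ∈ Set.uIoc r w, ‖g t / t‖ ≤ κ / (2 * c ^ 2) / (w / c) := by
    intro t ht
    obtain ⟨ht₁, ht₂⟩ := Set.mem_uIoc.1 ht |>.elim
      (fun h => (⟨by linarith, by linarith⟩ : w / c ≤ t ∧ t ≤ c * w))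
      (fun h => ⟨by linarith, by linarith⟩)
    have ht0 : 0 < t := hwc.trans_le ht₁
    have hgt := hbound (Set.mem_Ioi.2 ht0) (by
      rw [Real.dist_eq, sub_zero, abs_of_pos ht0]; linarith)
    rw [dist_zero_right] at hgt
    rw [norm_div, Real.norm_of_nonneg ht0.le]
    gcongr
  have hrw : |w - r| ≤ c * w := abs_le.2 ⟨by linarith, by linarith⟩
  calc |∫ t in r..w, g t / t|
      ≤ κ / (2 * c ^ 2) / (w / c) * |w - r| :=
        intervalIntegral.norm_integral_le_of_norm_le_const hint
    _ ≤ κ / (2 * c ^ 2) / (w / c) * (c * w) := by gcongr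
    _ = κ / 2 := by field_simp
    _ < κ := by linarith

/-- The auxiliary factor `G_F(r,w) = exp(∫_r^w (L - ID_F(t))/t dt)` tends to 1 as
`w → 0⁺` with `w/c ≤ r ≤ c w`, where `ID_F(t) = t F'(t)/F(t)` tends to `L` as `t → 0⁺`. -/
theorem stmt_5
    (c b : ℝ) (hc : 1 ≤ c) (hb : 0 < b)
    (F : ℝ → ℝ)
    (hF : ContDiffOn ℝ 1 F (Set.Ioc 0 b))
    (hF0 : ∀ t ∈ Set.Ioc (0:ℝ) b, F t ≠ 0)
    (L : ℝ)
    (hlim : Tendsto (fun t : ℝ => t * deriv F t / F t)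
      (nhdsWithin 0 (Set.Ioi 0)) (nhds L)) :
    ∀ ε > (0:ℝ), ∃ δ > (0:ℝ), δ ≤ b ∧
      ∀ w r : ℝ, 0 < w → w ≤ δ → w / c ≤ r → r ≤ c * w →
        |Real.exp (∫ t in r..w, (L - t * deriv F t / F t) / t) - 1| < ε := by
  intro ε hε
  obtain ⟨κ, hκ, hexp⟩ := Metric.continuousAt_iff.1 (Real.continuous_exp.continuousAt (x := 0)) ε hε
  have hg : Tendsto (fun t : ℝ => L - t * deriv F t / F t)
      (nhdsWithin 0 (Set.Ioi 0)) (nhds 0) := by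
    simpa using hlim.const_sub L
  obtain ⟨δ, hδ, hbound⟩ := exists_abs_integral_div_lt hc hg hκ
  refine ⟨min δ b, lt_min hδ hb, min_le_right _ _, fun w r hw hwδ hr₁ hr₂ => ?_⟩
  have hsmall := hbound w r hw (hwδ.trans (min_le_left _ _)) hr₁ hr₂
  simpa [Real.dist_eq] using hexp (by simpa [Real.dist_eq] using hsmall)
end

section
/- For every w > 0 and all θ₁ > 0, θ₂ > 0, the Kullback–Leibler divergence from H_{w|θ₁} to H_{w|θ₂} equals θ₂/θ₁ − ln(θ₂/θ₁) − 1; explicitly, ∫₀^w (θ₁/w)·(r/w)^{θ₁−1} · ln( ((θ₁/w)·(r/w)^{θ₁−1}) / ((θ₂/w)·(r/w)^{θ₂−1}) ) dr = θ₂/θ₁ − ln(θ₂/θ₁) − 1. -/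
open Real

lemma continuousOn_log_mul_rpow {s : ℝ} (hs : 0 < s) :
    ContinuousOn (fun x : ℝ => Real.log x * x ^ s) (Set.Icc 0 1) := by
  intro x hx
  rcases hx.1.eq_or_lt with rfl | hx0
  · have h : ContinuousWithinAt (fun x : ℝ => Real.log x * x ^ s) (Set.Ioi 0) 0 := by
      simpa [ContinuousWithinAt, hs.ne'] using tendsto_log_mul_rpow_nhdsGT_zero hs
    refine (continuousWithinAt_insert_self.mpr h).mono fun y hy => ?_
    simpa [Set.Ioi_insert] using hy.1
  · exact ((continuousAt_log hx0.ne').mul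
      (continuousAt_rpow_const x s (Or.inl hx0.ne'))).continuousWithinAt

lemma continuousOn_antideriv_log_mul_rpow {s : ℝ} (hs : 0 < s) :
    ContinuousOn (fun x : ℝ => x ^ s / s ^ 2 - Real.log x * x ^ s / s) (Set.Icc 0 1) :=
  ((continuous_rpow_const hs.le).continuousOn.div_const _).sub
    ((continuousOn_log_mul_rpow hs).div_const _)

lemma hasDerivAt_antideriv_log_mul_rpow {s x : ℝ} (hs : 0 < s) (hx : 0 < x) :
    HasDerivAt (fun x : ℝ => x ^ s / s ^ 2 - Real.log x * x ^ s / s)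
      (-(x ^ (s - 1) * Real.log x)) x := by
  have hpow := hasDerivAt_rpow_const (p := s) (Or.inl hx.ne')
  refine ((hpow.div_const (s ^ 2)).sub
    (((hasDerivAt_log hx.ne').mul hpow).div_const s)).congr_deriv ?_
  rw [rpow_sub_one hx.ne']
  field_simp
  ring

lemma intervalIntegrable_rpow_mul_log {s : ℝ} (hs : 0 < s) :
    IntervalIntegrable (fun x : ℝ => x ^ (s - 1) * Real.log x) MeasureTheory.volume 0 1 := by
  have h : MeasureTheory.IntegrableOn (fun x : ℝ => -(x ^ (s - 1) * Real.log x))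
      (Set.Ioc 0 1) :=
    intervalIntegral.integrableOn_deriv_of_nonneg (continuousOn_antideriv_log_mul_rpow hs)
      (fun x hx => hasDerivAt_antideriv_log_mul_rpow hs hx.1)
      (fun x hx => neg_nonneg.mpr (mul_nonpos_of_nonneg_of_nonpos (rpow_nonneg hx.1.le _)
        (log_nonpos hx.1.le hx.2.le)))
  simpa [Pi.neg_def] using ((intervalIntegrable_iff_integrableOn_Ioc_of_le zero_le_one).mpr h).neg

lemma integral_rpow_mul_log {s : ℝ} (hs : 0 < s) :
    ∫ x in (0 : ℝ)..1, x ^ (s - 1) * Real.log x = -(1 / s ^ 2) := by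
  have h := intervalIntegral.integral_eq_sub_of_hasDerivAt_of_le zero_le_one
    (continuousOn_antideriv_log_mul_rpow hs)
    (fun x hx => hasDerivAt_antideriv_log_mul_rpow hs hx.1)
    (intervalIntegrable_rpow_mul_log hs).neg
  rw [intervalIntegral.integral_neg] at h
  simp only [one_rpow, zero_rpow hs.ne', log_one, mul_zero, zero_mul, zero_div, sub_zero] at h
  linarith

/-- The KL divergence from `H_{w|θ₁}` to `H_{w|θ₂}` equals `θ₂/θ₁ - ln(θ₂/θ₁) - 1`. -/
theorem stmt_6 (w θ₁ θ₂ : ℝ) (hw : 0 < w) (hθ₁ : 0 < θ₁) (hθ₂ : 0 < θ₂) :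
    ∫ r in (0:ℝ)..w,
      (θ₁ / w) * (r / w) ^ (θ₁ - 1) *
        Real.log (((θ₁ / w) * (r / w) ^ (θ₁ - 1)) / ((θ₂ / w) * (r / w) ^ (θ₂ - 1)))
      = θ₂ / θ₁ - Real.log (θ₂ / θ₁) - 1 := by
  have hscale := intervalIntegral.integral_comp_div (a := 0) (b := w)
    (fun x : ℝ => (θ₁ / w) * x ^ (θ₁ - 1) *
        Real.log (((θ₁ / w) * x ^ (θ₁ - 1)) / ((θ₂ / w) * x ^ (θ₂ - 1)))) hw.ne'
  rw [hscale, zero_div, div_self hw.ne']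
  have hcongr : ∫ x in (0 : ℝ)..1, (θ₁ / w) * x ^ (θ₁ - 1) *
        Real.log (((θ₁ / w) * x ^ (θ₁ - 1)) / ((θ₂ / w) * x ^ (θ₂ - 1))) =
      ∫ x in (0 : ℝ)..1, (θ₁ / w * -Real.log (θ₂ / θ₁)) * x ^ (θ₁ - 1) +
        (θ₁ / w * (θ₁ - θ₂)) * (x ^ (θ₁ - 1) * Real.log x) := by
    refine intervalIntegral.integral_congr_uIoo fun x hx => ?_
    rw [Set.uIoo_of_le zero_le_one] at hx
    have hx0 : 0 < x := hx.1
    have h₁ := (rpow_pos_of_pos hx0 (θ₁ - 1)).ne'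
    have h₂ := (rpow_pos_of_pos hx0 (θ₂ - 1)).ne'
    have hw₁ := (div_pos hθ₁ hw).ne'
    have hw₂ := (div_pos hθ₂ hw).ne'
    rw [log_div (mul_ne_zero hw₁ h₁) (mul_ne_zero hw₂ h₂), log_mul hw₁ h₁, log_mul hw₂ h₂,
      log_rpow hx0, log_rpow hx0, log_div hθ₁.ne' hw.ne', log_div hθ₂.ne' hw.ne',
      log_div hθ₂.ne' hθ₁.ne']
    ring
  have hexp : -1 < θ₁ - 1 := by linarith
  rw [hcongr, intervalIntegral.integral_add
      ((intervalIntegral.intervalIntegrable_rpow' hexp).const_mul _)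
      ((intervalIntegrable_rpow_mul_log hθ₁).const_mul _),
    intervalIntegral.integral_const_mul, intervalIntegral.integral_const_mul,
    integral_rpow_mul_log hθ₁, integral_rpow (Or.inl hexp), sub_add_cancel, one_rpow,
    zero_rpow hθ₁.ne', smul_eq_mul]
  field_simp
  ring
end

section
/- Let N ≥ 1 and let d₁, …, d_N be positive real numbers. Define g(θ) = (1/N) · Σ_{i=1}^N ( d_i/θ − ln(d_i/θ) − 1 ) for θ > 0, and let θ_A = (1/N) · Σ_{i=1}^N d_i be the arithmetic mean of d₁, …, d_N. Then g(θ_A) ≤ g(θ) for every θ > 0, and g(θ) = g(θ_A) implies θ = θ_A; i.e., the arithmetic mean is the unique minimizer of g on (0, ∞). -/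
open Real Finset

/-- The mean of `dᵢ/θ - ln(dᵢ/θ) - 1` depends on `θ` only through `A/θ + ln θ`, where `A` is the
arithmetic mean of the `dᵢ`. -/
theorem mean_div_sub_log_div_sub_one {N : ℕ} (hN : 1 ≤ N) {d : Fin N → ℝ} (hd : ∀ i, 0 < d i)
    {θ : ℝ} (hθ : 0 < θ) :
    (1 / (N : ℝ)) * ∑ i, (d i / θ - Real.log (d i / θ) - 1) =
      ((1 / (N : ℝ)) * ∑ i, d i) / θ + Real.log θ - (1 / (N : ℝ)) * ∑ i, Real.log (d i) - 1 := by
  have hN' : (N : ℝ) ≠ 0 := by positivity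
  have hlog : ∀ i, Real.log (d i / θ) = Real.log (d i) - Real.log θ :=
    fun i => Real.log_div (hd i).ne' hθ.ne'
  simp only [hlog, Finset.sum_sub_distrib, ← Finset.sum_div, Finset.sum_const, Finset.card_univ,
    Fintype.card_fin, nsmul_eq_mul]
  field_simp
  ring

/-- The arithmetic mean is the unique minimizer of
`g(θ) = (1/N) Σ (dᵢ/θ - ln(dᵢ/θ) - 1)` over `θ > 0`. -/
theorem stmt_9 (N : ℕ) (hN : 1 ≤ N) (d : Fin N → ℝ) (hd : ∀ i, 0 < d i) :
    let g : ℝ → ℝ := fun θ => (1 / (N : ℝ)) * ∑ i, (d i / θ - Real.log (d i / θ) - 1)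
    let θA : ℝ := (1 / (N : ℝ)) * ∑ i, d i
    ∀ θ > (0:ℝ), g θA ≤ g θ ∧ (g θ = g θA → θ = θA) := by
  intro g θA θ hθ
  have : NeZero N := ⟨by lia⟩
  have hA : 0 < θA :=
    mul_pos (by positivity) (Finset.sum_pos (fun i _ => hd i) Finset.univ_nonempty)
  have key : g θ - g θA = θA / θ - 1 - Real.log (θA / θ) := by
    have h₁ : g θ = θA / θ + Real.log θ - (1 / (N : ℝ)) * ∑ i, Real.log (d i) - 1 :=
      mean_div_sub_log_div_sub_one hN hd hθ
    have h₂ : g θA = θA / θA + Real.log θA - (1 / (N : ℝ)) * ∑ i, Real.log (d i) - 1 :=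
      mean_div_sub_log_div_sub_one hN hd hA
    rw [h₁, h₂, Real.log_div hA.ne' hθ.ne', div_self hA.ne']
    ring
  have hpos : 0 < θA / θ := div_pos hA hθ
  refine ⟨by linarith [Real.log_le_sub_one_of_pos hpos], fun h => ?_⟩
  by_contra hne
  have hne' : θA / θ ≠ 1 := fun h1 => hne ((div_eq_one_iff_eq hθ.ne').mp h1).symm
  linarith [Real.log_lt_sub_one_of_pos hpos hne']
end

section
/- Let N ≥ 1 and let d₁, …, d_N be positive real numbers. Define h(θ) = (1/N) · Σ_{i=1}^N ( θ/d_i − ln(θ/d_i) − 1 ) for θ > 0, and let θ_H = N / ( Σ_{i=1}^N 1/d_i ) be the harmonic mean of d₁, …, d_N. Then h(θ_H) ≤ h(θ) for every θ > 0, and h(θ) = h(θ_H) implies θ = θ_H; i.e., the harmonic mean is the unique minimizer of h on (0, ∞). -/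
open Real Finset

theorem mean_div_sub_log_sub_one {N : ℕ} (hN : N ≠ 0) {d : Fin N → ℝ} (hd : ∀ i, 0 < d i)
    {θ : ℝ} (hθ : 0 < θ) :
    (1 / (N : ℝ)) * ∑ i, (θ / d i - Real.log (θ / d i) - 1) =
      θ * (∑ i, 1 / d i) / N - Real.log θ + (∑ i, Real.log (d i)) / N - 1 := by
  have hN' : (N : ℝ) ≠ 0 := Nat.cast_ne_zero.mpr hN
  have hterm : ∀ i, θ / d i - Real.log (θ / d i) - 1 =
      θ * (1 / d i) - (Real.log θ + 1) + Real.log (d i) := fun i => by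
    rw [Real.log_div hθ.ne' (hd i).ne']
    ring
  simp only [hterm, sum_add_distrib, sum_sub_distrib, ← mul_sum, sum_const, card_univ,
    Fintype.card_fin, nsmul_eq_mul]
  field_simp
  ring

/-- The harmonic mean is the unique minimizer of
`h(θ) = (1/N) Σ (θ/dᵢ - ln(θ/dᵢ) - 1)` over `θ > 0`. -/
theorem stmt_10 (N : ℕ) (hN : 1 ≤ N) (d : Fin N → ℝ) (hd : ∀ i, 0 < d i) :
    let h : ℝ → ℝ := fun θ => (1 / (N : ℝ)) * ∑ i, (θ / d i - Real.log (θ / d i) - 1)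
    let θH : ℝ := (N : ℝ) / ∑ i, 1 / d i
    ∀ θ > (0:ℝ), h θH ≤ h θ ∧ (h θ = h θH → θ = θH) := by
  intro h θH θ hθ
  have hN0 : N ≠ 0 := by omega
  have hNpos : (0 : ℝ) < N := by exact_mod_cast hN
  have hS : 0 < ∑ i, 1 / d i :=
    sum_pos (fun i _ => one_div_pos.mpr (hd i)) ⟨⟨0, hN⟩, mem_univ _⟩
  have hθH : 0 < θH := div_pos hNpos hS
  have hdiff : h θ - h θH = θ / θH - 1 - Real.log (θ / θH) := by
    have hlin : ∀ x : ℝ, x * (∑ i, 1 / d i) / N = x / θH := fun x => by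
      rw [div_div_eq_mul_div]
    simp only [h]
    rw [mean_div_sub_log_sub_one hN0 hd hθ, mean_div_sub_log_sub_one hN0 hd hθH,
      Real.log_div hθ.ne' hθH.ne', hlin, hlin, div_self hθH.ne']
    ring
  have hpos : 0 < θ / θH := div_pos hθ hθH
  refine ⟨by linarith [Real.log_le_sub_one_of_pos hpos], fun heq => ?_⟩
  by_contra hne
  have hlt := Real.log_lt_sub_one_of_pos hpos fun h1 => hne ((div_eq_one_iff_eq hθH.ne').mp h1)
  linarith
end
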